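/- arXiv:2506.13547 — 2 statements merged into one kernel-verified Lean document; each statement's English description precedes it below -/
import Mathlib

section
/- Let m ≥ 2 and let K ≠ Δ_{[m]} be a simplicial complex on [m]. For any two faces (I₁,J₁) and (I₂,J₂) of Bier(K), the pair (I₁∩I₂, J₁∩J₂) is again a face of Bier(K) and C(I₁,J₁) ∩ C(I₂,J₂) = C(I₁∩I₂, J₁∩J₂). (Any two cones of the canonical fan Σ_K intersect in a common face.) -/
open Finset

/-- The vectors `e_1, ..., e_m` in `ℝ^{m-1}`: for `i` with `(i : ℕ) < m - 1` this is the
standard basis vector, and the last one is `e_m = -(e_1 + ⋯ + e_{m-1})`,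
i.e. the all-(-1) vector. -/
noncomputable def bierVec (m : ℕ) (i : Fin m) : Fin (m - 1) → ℝ :=
  if h : (i : ℕ) < m - 1 then Pi.single ⟨i, h⟩ 1 else fun _ => -1

/-- The cone `C(I, J)`: all nonnegative combinations of the `-e_i`, `i ∈ I`,
and the `e_j`, `j ∈ J`. -/
def coneC (m : ℕ) (I J : Finset (Fin m)) : Set (Fin (m - 1) → ℝ) :=
  {x | ∃ a b : Fin m → ℝ, (∀ i, 0 ≤ a i) ∧ (∀ j, 0 ≤ b j) ∧
    x = ∑ i ∈ I, a i • (-(bierVec m i)) + ∑ j ∈ J, b j • bierVec m j}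

/-- `K` is a simplicial complex on `[m]` (with ghost vertices allowed):
a nonempty collection of subsets of `[m]` closed under passing to subsets. -/
def IsSimplicialComplex (m : ℕ) (K : Finset (Finset (Fin m))) : Prop :=
  K.Nonempty ∧ ∀ s ∈ K, ∀ t ⊆ s, t ∈ K

/-- `(I, J)` is a face of the Bier sphere `Bier(K)`: `I` and `J` are disjoint,
`I ∈ K` and `J ∈ K^∨`, i.e. `[m] \ J ∉ K`. -/
def IsBierFace (m : ℕ) (K : Finset (Finset (Fin m))) (I J : Finset (Fin m)) : Prop :=
  Disjoint I J ∧ I ∈ K ∧ Finset.univ \ J ∉ K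

theorem sum_smul_bierVec_apply {n : ℕ} (c : Fin (n + 1) → ℝ) (k : Fin n) :
    (∑ i, c i • bierVec (n + 1) i) k = c k.castSucc - c (Fin.last n) := by
  have hcast : ∀ i : Fin n, bierVec (n + 1) i.castSucc = Pi.single i 1 := fun i => by
    simp [bierVec]
  have hlast : bierVec (n + 1) (Fin.last n) = fun _ => -1 := by simp [bierVec]
  rw [Fin.sum_univ_castSucc]
  simp only [hcast, hlast]
  change (∑ i : Fin n, c i.castSucc • (Pi.single i (1 : ℝ) : Fin n → ℝ)
    + c (Fin.last n) • fun _ : Fin n => (-1 : ℝ)) k = _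
  simp [Finset.sum_apply, Pi.single_apply, sub_eq_add_neg]

/-- Two coefficient families represent the same vector only if they differ by a constant. -/
theorem exists_eq_add_of_sum_smul_bierVec_eq {m : ℕ} (f g : Fin m → ℝ)
    (h : ∑ i, f i • bierVec m i = ∑ i, g i • bierVec m i) : ∃ c, ∀ i, f i = g i + c := by
  cases m with
  | zero => exact ⟨0, fun i => i.elim0⟩
  | succ n =>
    refine ⟨f (Fin.last n) - g (Fin.last n), fun i => ?_⟩
    induction i using Fin.lastCases with
    | last => ring
    | cast k =>
      have hk := congrFun h k
      rw [sum_smul_bierVec_apply, sum_smul_bierVec_apply] at hk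
      linarith

/-- Membership in `C(I, J)` through a single signed family of coefficients. -/
theorem mem_coneC_iff {m : ℕ} {I J : Finset (Fin m)} {x : Fin (m - 1) → ℝ} :
    x ∈ coneC m I J ↔ ∃ f : Fin m → ℝ, (∀ i, 0 < f i → i ∈ J) ∧ (∀ i, f i < 0 → i ∈ I) ∧
      x = ∑ i, f i • bierVec m i := by
  constructor
  · rintro ⟨a, b, ha, hb, rfl⟩
    refine ⟨fun i => (if i ∈ J then b i else 0) - (if i ∈ I then a i else 0), ?_, ?_, ?_⟩
    · intro i hi
      by_contra hJ
      have := ha i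
      simp only [hJ, if_false] at hi
      split_ifs at hi <;> linarith
    · intro i hi
      by_contra hI
      have := hb i
      simp only [hI, if_false] at hi
      split_ifs at hi <;> linarith
    simp [sub_smul, Finset.sum_sub_distrib, ite_smul, neg_add_eq_sub]
  · rintro ⟨f, hJ, hI, rfl⟩
    refine ⟨fun i => max (-f i) 0, fun i => max (f i) 0, fun i => le_max_right _ _,
      fun i => le_max_right _ _, ?_⟩
    rw [Finset.sum_subset (Finset.subset_univ I), Finset.sum_subset (Finset.subset_univ J),
      ← Finset.sum_add_distrib]
    · refine Finset.sum_congr rfl fun i _ => ?_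
      rw [smul_neg, ← neg_smul, ← add_smul]
      congr 1
      rcases le_total (f i) 0 with h | h
      · simp [h]
      · simp [h]
    · intro i _ hi
      have : f i ≤ 0 := not_lt.1 fun h => hi (hJ i h)
      simp [this]
    · intro i _ hi
      have : 0 ≤ f i := not_lt.1 fun h => hi (hI i h)
      simp [this]

theorem coneC_mono {m : ℕ} {I I' J J' : Finset (Fin m)} (hI : I ⊆ I') (hJ : J ⊆ J') :
    coneC m I J ⊆ coneC m I' J' := fun _ hx => by
  obtain ⟨f, hfJ, hfI, hf⟩ := mem_coneC_iff.1 hx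
  exact mem_coneC_iff.2 ⟨f, fun i h => hJ (hfJ i h), fun i h => hI (hfI i h), hf⟩

/-- If `f = g + c` with `f` nonpositive off `J` and `g` nonnegative off `I`, then `c ≤ 0`,
since otherwise the non-face `[m] \ J` would lie inside the face `I`. -/
theorem shift_nonpos_of_mem_of_compl_notMem {m : ℕ} {K : Finset (Finset (Fin m))}
    (hK : IsSimplicialComplex m K) {I J : Finset (Fin m)} (hI : I ∈ K)
    (hJ : Finset.univ \ J ∉ K) {f g : Fin m → ℝ} {c : ℝ} (hfg : ∀ i, f i = g i + c)
    (hf : ∀ i, 0 < f i → i ∈ J) (hg : ∀ i, g i < 0 → i ∈ I) : c ≤ 0 := by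
  by_contra! hc
  refine hJ (hK.2 I hI _ fun i hi => hg i ?_)
  have hiJ : i ∉ J := (Finset.mem_sdiff.1 hi).2
  have : f i ≤ 0 := not_lt.1 fun h => hiJ (hf i h)
  linarith [hfg i]


/-- Any two cones of the canonical fan `Σ_K` intersect in a common face: for faces
`(I₁, J₁)` and `(I₂, J₂)` of `Bier(K)`, the pair `(I₁ ∩ I₂, J₁ ∩ J₂)` is again a face
of `Bier(K)` and `C(I₁, J₁) ∩ C(I₂, J₂) = C(I₁ ∩ I₂, J₁ ∩ J₂)`. -/
theorem bier_fan_cone_intersection (m : ℕ) (hm : 2 ≤ m) (K : Finset (Finset (Fin m)))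
    (hK : IsSimplicialComplex m K) (hKne : K ≠ (Finset.univ : Finset (Fin m)).powerset)
    (I₁ J₁ I₂ J₂ : Finset (Fin m))
    (h₁ : IsBierFace m K I₁ J₁) (h₂ : IsBierFace m K I₂ J₂) :
    IsBierFace m K (I₁ ∩ I₂) (J₁ ∩ J₂) ∧
      coneC m I₁ J₁ ∩ coneC m I₂ J₂ = coneC m (I₁ ∩ I₂) (J₁ ∩ J₂) := by
  refine ⟨⟨h₁.1.mono Finset.inter_subset_left Finset.inter_subset_left,
    hK.2 _ h₁.2.1 _ Finset.inter_subset_left, fun h => h₁.2.2 (hK.2 _ h _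
      (Finset.sdiff_subset_sdiff subset_rfl Finset.inter_subset_left))⟩, ?_⟩
  refine Set.Subset.antisymm ?_ (Set.subset_inter
    (coneC_mono Finset.inter_subset_left Finset.inter_subset_left)
    (coneC_mono Finset.inter_subset_right Finset.inter_subset_right))
  rintro x ⟨hx₁, hx₂⟩
  obtain ⟨f, hfJ, hfI, hf⟩ := mem_coneC_iff.1 hx₁
  obtain ⟨g, hgJ, hgI, hg⟩ := mem_coneC_iff.1 hx₂
  obtain ⟨c, hc⟩ := exists_eq_add_of_sum_smul_bierVec_eq f g (hf ▸ hg)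
  have hc_nonpos : c ≤ 0 := shift_nonpos_of_mem_of_compl_notMem hK h₂.2.1 h₁.2.2 hc hfJ hgI
  have hc_nonneg : -c ≤ 0 := shift_nonpos_of_mem_of_compl_notMem hK h₁.2.1 h₂.2.2
    (fun i => by linarith [hc i]) hgJ hfI
  obtain rfl : f = g := funext fun i => by linarith [hc i]
  exact mem_coneC_iff.2 ⟨f, fun i h => Finset.mem_inter.2 ⟨hfJ i h, hgJ i h⟩,
    fun i h => Finset.mem_inter.2 ⟨hfI i h, hgI i h⟩, hf⟩
end

section
/- Let m ≥ 2 and let K ≠ Δ_{[m]} be a simplicial complex on [m]. Define the geometric realization |Bier(K)| ⊂ ℝ^{m−1} as the union, over all faces (I,J) of Bier(K) with (I,J) ≠ (∅,∅), of the convex hulls conv(G(I,J)). Then for every nonzero x ∈ ℝ^{m−1} there exists exactly one t > 0 such that t·x ∈ |Bier(K)|; i.e., every ray emanating from the origin meets |Bier(K)| in exactly one point, so Bier(K) is realized as a starshaped sphere with star center the origin. -/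
open Finset

/-- The set `G(I, J) = {-e_i : i ∈ I} ∪ {e_j : j ∈ J}` of generators, as a subset
of `ℝ^{m-1}`. -/
def bierGenSet (m : ℕ) (I J : Finset (Fin m)) : Set (Fin (m - 1) → ℝ) :=
  ((fun i => -(bierVec m i)) '' (I : Set (Fin m))) ∪ (bierVec m '' (J : Set (Fin m)))

/-- The sum of all the vectors `e_i` with coefficients `w` has coordinates `w_k - w_m`. -/
lemma sum_smul_bierVec_apply_s9 (m : ℕ) (hm : 0 < m) (w : Fin m → ℝ) (k : Fin (m - 1)) :
    (∑ i, w i • bierVec m i) k =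
      w ⟨k, by omega⟩ - w ⟨m - 1, by omega⟩ := by
  obtain ⟨n, rfl⟩ : ∃ n, m = n + 1 := ⟨m - 1, by omega⟩
  rw [Fin.sum_univ_castSucc]
  have h_cast (i : Fin n) : bierVec (n + 1) i.castSucc = (Pi.single i 1 : Fin n → ℝ) := by
    simp [bierVec]
  have h_last : bierVec (n + 1) (Fin.last n) = fun _ => (-1 : ℝ) := by
    simp [bierVec]
  have h_sum : (∑ i : Fin n, w i.castSucc • (Pi.single i 1 : Fin n → ℝ)) k =
      w (Fin.castSucc k) := by
    simp [Finset.sum_apply, Pi.single_apply]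
  simp only [h_cast, h_last]
  refine (congrArg (· + (w (Fin.last n) • fun _ : Fin n => (-1 : ℝ)) k) h_sum).trans ?_
  simp only [Pi.smul_apply, smul_eq_mul, mul_neg, mul_one, ← sub_eq_add_neg]
  rfl

/-- Coefficients realizing the same vector differ by a constant. -/
lemma exists_eq_add_const_of_sum_smul_bierVec_eq (m : ℕ) (hm : 0 < m) (v w : Fin m → ℝ)
    (h : ∑ i, v i • bierVec m i = ∑ i, w i • bierVec m i) : ∃ d : ℝ, ∀ i, v i = w i + d := by
  refine ⟨v ⟨m - 1, by omega⟩ - w ⟨m - 1, by omega⟩, fun i => ?_⟩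
  by_cases hi : (i : ℕ) < m - 1
  · have hk := congrFun h ⟨i, hi⟩
    rw [sum_smul_bierVec_apply_s9 m hm, sum_smul_bierVec_apply_s9 m hm] at hk
    simp only [Fin.eta] at hk
    linarith
  · have hlast : i = ⟨m - 1, by omega⟩ := Fin.ext (by simp only; omega)
    rw [← hlast]
    ring

/-- Every vector is a combination of the `e_i`, with coefficients shiftable by a constant. -/
lemma exists_sum_smul_bierVec_eq (m : ℕ) (hm : 0 < m) (x : Fin (m - 1) → ℝ) :
    ∃ y : Fin m → ℝ, ∀ c : ℝ, ∑ i, (y i - c) • bierVec m i = x := by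
  refine ⟨fun i => if h : (i : ℕ) < m - 1 then x ⟨i, h⟩ else 0, fun c => ?_⟩
  ext k
  rw [sum_smul_bierVec_apply_s9 m hm]
  simp

/-- Points of `conv G(I, J)` are sign-constrained combinations of the `e_i` of total weight one. -/
lemma exists_coeff_of_mem_convexHull (m : ℕ) {I J : Finset (Fin m)} (hIJ : Disjoint I J)
    {z : Fin (m - 1) → ℝ} (hz : z ∈ convexHull ℝ (bierGenSet m I J)) :
    ∃ w : Fin m → ℝ, z = ∑ i, w i • bierVec m i ∧ ∑ i, |w i| = 1 ∧
      (∀ i ∉ I, 0 ≤ w i) ∧ ∀ i ∉ J, w i ≤ 0 := by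
  let S : Set (Fin (m - 1) → ℝ) := {z | ∃ w : Fin m → ℝ, z = ∑ i, w i • bierVec m i ∧
    ∑ i, |w i| = 1 ∧ (∀ i ∉ I, 0 ≤ w i) ∧ ∀ i ∉ J, w i ≤ 0}
  suffices h : convexHull ℝ (bierGenSet m I J) ⊆ S from h hz
  refine convexHull_min ?_ ?_
  · rintro _ (⟨i, hi, rfl⟩ | ⟨j, hj, rfl⟩)
    · refine ⟨-Pi.single i 1, by simp [Pi.single_apply], by simp [Pi.single_apply, apply_ite abs],
        fun k hk => ?_, fun k _ => ?_⟩
      · have : k ≠ i := fun h => hk (h ▸ hi)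
        simp [this]
      · by_cases h : k = i <;> simp [h]
    · refine ⟨Pi.single j 1, by simp [Pi.single_apply], by simp [Pi.single_apply, apply_ite abs],
        fun k _ => ?_, fun k hk => ?_⟩
      · by_cases h : k = j <;> simp [h]
      · have : k ≠ j := fun h => hk (h ▸ hj)
        simp [this]
  · rintro _ ⟨v, rfl, hv, hvI, hvJ⟩ _ ⟨w, rfl, hw, hwI, hwJ⟩ a b ha hb hab
    refine ⟨fun i => a * v i + b * w i, ?_, ?_, fun i hi => ?_, fun i hi => ?_⟩
    · simp only [Finset.smul_sum, add_smul, mul_smul, Finset.sum_add_distrib]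
    · have h_abs (i : Fin m) : |a * v i + b * w i| = a * |v i| + b * |w i| := by
        by_cases hi : i ∈ I
        · have hiJ := Finset.disjoint_left.mp hIJ hi
          have h1 := hvJ i hiJ
          have h2 := hwJ i hiJ
          rw [abs_of_nonpos h1, abs_of_nonpos h2, abs_of_nonpos (by nlinarith)]
          ring
        · have h1 := hvI i hi
          have h2 := hwI i hi
          rw [abs_of_nonneg h1, abs_of_nonneg h2, abs_of_nonneg (by positivity)]
      simp only [h_abs, Finset.sum_add_distrib, ← Finset.mul_sum, hv, hw, mul_one, hab]
    · have h1 := hvI i hi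
      have h2 := hwI i hi
      positivity
    · have h1 := hvJ i hi
      have h2 := hwJ i hi
      nlinarith

/-- Combinations of the `e_i` of total weight one lie in the hull given by their sign pattern. -/
lemma sum_smul_bierVec_mem_convexHull (m : ℕ) (w : Fin m → ℝ) (hw : ∑ i, |w i| = 1) :
    ∑ i, w i • bierVec m i ∈
      convexHull ℝ (bierGenSet m {i | w i < 0} {i | 0 < w i}) := by
  have h_sum : ∑ i, w i • bierVec m i =
      ∑ i with w i ≠ 0, |w i| • (if w i < 0 then -bierVec m i else bierVec m i) := by
    rw [Finset.sum_filter]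
    refine Finset.sum_congr rfl fun i _ => ?_
    rcases lt_trichotomy (w i) 0 with h | h | h
    · simp [h, h.ne, abs_of_neg]
    · simp [h]
    · simp [h.ne', h.not_gt, abs_of_pos h]
  rw [h_sum]
  refine (convex_convexHull ℝ _).sum_mem (fun i _ => abs_nonneg _) ?_ fun i hi => ?_
  · rw [← hw, Finset.sum_filter]
    refine Finset.sum_congr rfl fun i _ => ?_
    by_cases h : w i = 0 <;> simp [h]
  · refine subset_convexHull ℝ _ ?_
    rcases lt_or_gt_of_ne (Finset.mem_filter.mp hi).2 with h | h
    · rw [if_pos h]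
      exact Or.inl ⟨i, by simpa using h, rfl⟩
    · rw [if_neg h.not_gt]
      exact Or.inr ⟨i, by simpa using h, rfl⟩

/-- The realization of `Bier(K)` in terms of coefficient vectors: the negative support lies in `K`,
the nonpositive support does not. -/
lemma mem_bier_realization_iff (m : ℕ) (K : Finset (Finset (Fin m)))
    (hK : IsSimplicialComplex m K) (z : Fin (m - 1) → ℝ) :
    (z ∈ ⋃ (I : Finset (Fin m)) (J : Finset (Fin m))
        (_ : IsBierFace m K I J ∧ ¬(I = ∅ ∧ J = ∅)), convexHull ℝ (bierGenSet m I J)) ↔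
      ∃ w : Fin m → ℝ, z = ∑ i, w i • bierVec m i ∧ ∑ i, |w i| = 1 ∧
        ({i | w i < 0} : Finset (Fin m)) ∈ K ∧ ({i | w i ≤ 0} : Finset (Fin m)) ∉ K := by
  simp only [Set.mem_iUnion]
  constructor
  · rintro ⟨I, J, ⟨⟨hIJ, hI, hJ⟩, -⟩, hz⟩
    obtain ⟨w, hzw, hw, hwI, hwJ⟩ := exists_coeff_of_mem_convexHull m hIJ hz
    refine ⟨w, hzw, hw, hK.2 I hI _ fun i hi => ?_, fun h => hJ (hK.2 _ h _ fun i hi => ?_)⟩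
    · by_contra hiI
      exact (hwI i hiI).not_gt (by simpa using hi)
    · simpa using hwJ i (by simpa using hi)
  · rintro ⟨w, rfl, hw, hneg, hnonpos⟩
    refine ⟨({i | w i < 0} : Finset (Fin m)), ({i | 0 < w i} : Finset (Fin m)),
      ⟨⟨?_, hneg, ?_⟩, ?_⟩, sum_smul_bierVec_mem_convexHull m w hw⟩
    · exact Finset.disjoint_filter.mpr fun i _ h => h.not_gt
    · convert hnonpos using 2
      ext i
      simp
    · rintro ⟨h1, h2⟩
      have h_zero (i : Fin m) : w i = 0 := by
        have hn : ¬ w i < 0 := by simpa using Finset.filter_eq_empty_iff.mp h1 (Finset.mem_univ i)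
        have hp : ¬ 0 < w i := by simpa using Finset.filter_eq_empty_iff.mp h2 (Finset.mem_univ i)
        linarith
      simp [h_zero] at hw

/-- Sublevel sets of `y` leave the complex `K` at a threshold value. -/
lemma exists_threshold (m : ℕ) (K : Finset (Finset (Fin m))) (hK : IsSimplicialComplex m K)
    (hKne : K ≠ (Finset.univ : Finset (Fin m)).powerset) (y : Fin m → ℝ) :
    ∃ c : ℝ, ({i | y i < c} : Finset (Fin m)) ∈ K ∧ ({i | y i ≤ c} : Finset (Fin m)) ∉ K := by
  have h_empty : ∅ ∈ K := hK.1.elim fun s hs => hK.2 s hs ∅ (Finset.empty_subset s)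
  have h_univ : Finset.univ ∉ K := fun h => hKne <| Finset.ext fun s => by
    simpa using hK.2 _ h s (Finset.subset_univ s)
  have h_of_max (s : Finset (Fin m)) (hs : s ∉ K) : ∃ i ∈ s, ∀ j ∈ s, y j ≤ y i :=
    s.exists_max_image y <| Finset.nonempty_iff_ne_empty.mpr fun h => hs (h ▸ h_empty)
  let B : Finset (Fin m) := {i | ({j | y j ≤ y i} : Finset (Fin m)) ∉ K}
  have hB : B.Nonempty := by
    obtain ⟨i, -, hi⟩ := h_of_max _ h_univ
    refine ⟨i, Finset.mem_filter.mpr ⟨Finset.mem_univ i, fun h => h_univ ?_⟩⟩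
    exact hK.2 _ h _ fun j _ => by simpa using hi j (Finset.mem_univ j)
  obtain ⟨i, hi, hmin⟩ := B.exists_min_image y hB
  refine ⟨y i, ?_, (Finset.mem_filter.mp hi).2⟩
  by_contra hlt
  obtain ⟨k, hk, hkmax⟩ := h_of_max _ hlt
  have hki : y k < y i := by simpa using hk
  refine (hmin k (Finset.mem_filter.mpr ⟨Finset.mem_univ k, fun h => hlt ?_⟩)).not_gt hki
  exact hK.2 _ h _ fun j hj => by simpa using hkmax j hj

/-- If positive multiples of `v` and `w` differ by a constant shift `d`, the negative support of `w`
is in `K` and the nonpositive support of `v` is not, then `d` is nonpositive. -/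
lemma shift_nonpos_of_straddle (m : ℕ) (K : Finset (Finset (Fin m)))
    (hK : IsSimplicialComplex m K) {v w : Fin m → ℝ} {s t d : ℝ} (hs : 0 < s) (ht : 0 < t)
    (h : ∀ i, s * v i = t * w i + d) (hw : ({i | w i < 0} : Finset (Fin m)) ∈ K)
    (hv : ({i | v i ≤ 0} : Finset (Fin m)) ∉ K) : d ≤ 0 := by
  by_contra! hd
  refine hv (hK.2 _ hw _ fun i hi => ?_)
  have hvi : v i ≤ 0 := by simpa using hi
  have : t * w i < 0 := by nlinarith [h i]
  simpa using neg_of_mul_neg_right this ht.le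

/-- The canonical realization of `Bier(K)` (the union of the convex hulls of the `G(I,J)`
over the nonempty faces `(I, J)`) is a starshaped sphere with star center the origin:
every ray emanating from `0` meets it in exactly one point. -/
theorem bier_realization_starshaped (m : ℕ) (hm : 2 ≤ m) (K : Finset (Finset (Fin m)))
    (hK : IsSimplicialComplex m K) (hKne : K ≠ (Finset.univ : Finset (Fin m)).powerset) :
    ∀ x : Fin (m - 1) → ℝ, x ≠ 0 →
      ∃! t : ℝ, 0 < t ∧ t • x ∈
        ⋃ (I : Finset (Fin m)) (J : Finset (Fin m))
          (_ : IsBierFace m K I J ∧ ¬(I = ∅ ∧ J = ∅)),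
            convexHull ℝ (bierGenSet m I J) := by
  intro x hx
  have hm0 : 0 < m := by omega
  simp only [mem_bier_realization_iff m K hK]
  obtain ⟨y, hy⟩ := exists_sum_smul_bierVec_eq m hm0 x
  obtain ⟨c, hlt, hle⟩ := exists_threshold m K hK hKne y
  have hN : 0 < ∑ i, |y i - c| := by
    refine (Finset.sum_nonneg fun i _ => abs_nonneg _).lt_of_ne' fun h => hx ?_
    rw [Finset.sum_eq_zero_iff_of_nonneg fun i _ => abs_nonneg _] at h
    rw [← hy c]
    exact Finset.sum_eq_zero fun i hi => by rw [abs_eq_zero.mp (h i hi), zero_smul]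
  set N := ∑ i, |y i - c| with hN_def
  refine existsUnique_of_exists_of_unique
    ⟨N⁻¹, inv_pos.mpr hN, fun i => N⁻¹ * (y i - c), ?_, ?_, ?_, ?_⟩ ?_
  · simp only [mul_smul, ← Finset.smul_sum, hy c]
  · simp only [abs_mul, abs_of_pos (inv_pos.mpr hN), ← Finset.mul_sum, ← hN_def]
    exact inv_mul_cancel₀ hN.ne'
  · simpa [mul_neg_iff, hN, hN.not_gt] using hlt
  · simpa [mul_nonpos_iff, hN, hN.not_ge, hN.le] using hle
  · rintro s t ⟨hs, v, hxv, hv, hvlt, hvle⟩ ⟨ht, w, hxw, hw, hwlt, hwle⟩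
    obtain ⟨d, hd⟩ := exists_eq_add_const_of_sum_smul_bierVec_eq m hm0
      (fun i => t * v i) (fun i => s * w i) (by
        simp only [mul_smul, ← Finset.smul_sum, ← hxv, ← hxw]
        rw [smul_comm])
    have h1 : d ≤ 0 := shift_nonpos_of_straddle m K hK ht hs hd hwlt hvle
    have h2 : -d ≤ 0 :=
      shift_nonpos_of_straddle m K hK hs ht (fun i => by linarith [hd i]) hvlt hwle
    have hd0 : d = 0 := by linarith
    have h_abs (i : Fin m) : t * |v i| = s * |w i| := by
      rw [← abs_of_pos hs, ← abs_of_pos ht, ← abs_mul, ← abs_mul]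
      simpa [abs_of_pos hs, abs_of_pos ht, hd0] using congrArg abs (hd i)
    have h_total := Finset.sum_congr (rfl : (Finset.univ : Finset (Fin m)) = _) fun i _ => h_abs i
    rw [← Finset.mul_sum, ← Finset.mul_sum, hv, hw] at h_total
    linarith
end
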